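/- Let μ be a unit pure quaternion and A ∈ ℍ^{n₁×n₂×n₃}. Then the infimum, over all m ∈ ℕ and all tensors X ∈ ℍ^{n₁×m×n₃}, Y ∈ ℍ^{n₂×m×n₃} with A = X *_μ Y*, of ½(‖X‖_F² + ‖Y‖_F²) equals (1/n₃)·Σ_{l=1}^{n₃} of the infimum, over all m_l ∈ ℕ and quaternion matrices X_l ∈ ℍ^{n₁×m_l}, Y_l ∈ ℍ^{n₂×m_l} with Â^{(l)} = X_l Y_l*, of ½(‖X_l‖_F² + ‖Y_l‖_F²); moreover both infima are attained (one may take m = m_l = min(n₁,n₂)). -/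

import Mathlib

noncomputable section
open Matrix Kronecker Filter Topology

namespace QTpaper

/-- The quaternion unit `i`. -/
def qi : Quaternion ℝ := ⟨0, 1, 0, 0⟩
/-- The quaternion unit `j`. -/
def qj : Quaternion ℝ := ⟨0, 0, 1, 0⟩
/-- The quaternion unit `k`. -/
def qk : Quaternion ℝ := ⟨0, 0, 0, 1⟩

/-- A unit pure quaternion: zero real part and norm one. -/
def UnitPure (μ : Quaternion ℝ) : Prop := μ.re = 0 ∧ ‖μ‖ = 1

/-- Third-order quaternion tensors. -/
abbrev QTensor (a b c : ℕ) := Fin a → Fin b → Fin c → Quaternion ℝ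

/-- `l`-th frontal slice of a third-order tensor. -/
def fslice {a b c : ℕ} (A : QTensor a b c) (l : Fin c) :
    Matrix (Fin a) (Fin b) (Quaternion ℝ) := fun p q => A p q l

/-- Frobenius norm of a quaternion matrix. -/
def frobM {m n : ℕ} (A : Matrix (Fin m) (Fin n) (Quaternion ℝ)) : ℝ :=
  Real.sqrt (∑ p, ∑ q, ‖A p q‖ ^ 2)

/-- Frobenius norm of a third-order quaternion tensor. -/
def frobT {a b c : ℕ} (A : QTensor a b c) : ℝ :=
  Real.sqrt (∑ p, ∑ q, ∑ l, ‖A p q l‖ ^ 2)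

/-- The normalized QDFT matrix `F_{μ,n}` with entries
`(1/√n)·ω^{(p-1)(q-1)}`, `ω^m = cos(2πm/n) − μ·sin(2πm/n)`. -/
def Fq (μ : Quaternion ℝ) (n : ℕ) : Matrix (Fin n) (Fin n) (Quaternion ℝ) :=
  fun p q =>
    ((1 / Real.sqrt n : ℝ) : Quaternion ℝ) *
      (((Real.cos (2 * Real.pi * (p.1 * q.1) / n) : ℝ) : Quaternion ℝ)
        - ((Real.sin (2 * Real.pi * (p.1 * q.1) / n) : ℝ) : Quaternion ℝ) * μ)

/-- The permutation matrix `P_n` (1-based: `P₁₁ = 1`, `P_{pq} = 1` for `p+q = n+2`). -/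
def Pmat (n : ℕ) : Matrix (Fin n) (Fin n) ℝ :=
  fun p q => if (p.1 = 0 ∧ q.1 = 0) ∨ (p.1 + q.1 = n) then 1 else 0

/-- Block circulant matrix of a third-order tensor. -/
def circ {a b c : ℕ} (A : QTensor a b c) :
    Matrix (Fin c × Fin a) (Fin c × Fin b) (Quaternion ℝ) :=
  fun pi qj => A pi.2 qj.2 (pi.1 - qj.1)

/-- `unfold` stacks the frontal slices vertically. -/
def unfold3 {a b c : ℕ} (A : QTensor a b c) :
    Matrix (Fin c × Fin a) (Fin b) (Quaternion ℝ) :=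
  fun pi q => A pi.2 q pi.1

/-- `fold` is the inverse of `unfold`. -/
def fold3 {a b c : ℕ} (M : Matrix (Fin c × Fin a) (Fin b) (Quaternion ℝ)) :
    QTensor a b c := fun p q l => M (l, p) q

/-- Block diagonal matrix whose `l`-th diagonal block is the `l`-th frontal slice. -/
def diagT {a b c : ℕ} (A : QTensor a b c) :
    Matrix (Fin c × Fin a) (Fin c × Fin b) (Quaternion ℝ) :=
  fun pi qj => if pi.1 = qj.1 then A pi.2 qj.2 pi.1 else 0

/-- The QDFT along mode 3: `fft(A)(p,q,:) = √n₃ · F_{μ,n₃} · A(p,q,:)`. -/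
def fftT {a b c : ℕ} (μ : Quaternion ℝ) (A : QTensor a b c) : QTensor a b c :=
  fun p q l => ((Real.sqrt c : ℝ) : Quaternion ℝ) * ∑ m, Fq μ c l m * A p q m

/-- Real-part component tensor. -/
def compE {a b c : ℕ} (A : QTensor a b c) : QTensor a b c :=
  fun p q l => (((A p q l).re : ℝ) : Quaternion ℝ)
/-- `i`-component tensor. -/
def compI {a b c : ℕ} (A : QTensor a b c) : QTensor a b c :=
  fun p q l => (((A p q l).imI : ℝ) : Quaternion ℝ)
/-- `j`-component tensor. -/
def compJ {a b c : ℕ} (A : QTensor a b c) : QTensor a b c :=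
  fun p q l => (((A p q l).imJ : ℝ) : Quaternion ℝ)
/-- `k`-component tensor. -/
def compK {a b c : ℕ} (A : QTensor a b c) : QTensor a b c :=
  fun p q l => (((A p q l).imK : ℝ) : Quaternion ℝ)

/-- For `μ = a·i + b·j + c·k`, `μ_i = a·i − b·j − c·k`. -/
def mui (μ : Quaternion ℝ) : Quaternion ℝ := ⟨0, μ.imI, -μ.imJ, -μ.imK⟩
/-- For `μ = a·i + b·j + c·k`, `μ_j = −a·i + b·j − c·k`. -/
def muj (μ : Quaternion ℝ) : Quaternion ℝ := ⟨0, -μ.imI, μ.imJ, -μ.imK⟩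
/-- For `μ = a·i + b·j + c·k`, `μ_k = −a·i − b·j + c·k`. -/
def muk (μ : Quaternion ℝ) : Quaternion ℝ := ⟨0, -μ.imI, -μ.imJ, μ.imK⟩

/-- `T` matrix `F_{ν,n}^* · F_{μ,n}`. -/
def Tm (ν μ : Quaternion ℝ) (n : ℕ) : Matrix (Fin n) (Fin n) (Quaternion ℝ) :=
  (Fq ν n)ᴴ * Fq μ n

/-- The gQt-product of third-order quaternion tensors. -/
def gQt {n₁ r n₂ n₃ : ℕ} (μ : Quaternion ℝ) (A : QTensor n₁ r n₃)
    (B : QTensor r n₂ n₃) : QTensor n₁ n₂ n₃ :=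
  fold3 ((circ (compE A)
      + qi • (circ (compI A) * (Tm (mui μ) μ n₃ ⊗ₖ (1 : Matrix (Fin r) (Fin r) (Quaternion ℝ))))
      + qj • (circ (compJ A) * (Tm (muj μ) μ n₃ ⊗ₖ (1 : Matrix (Fin r) (Fin r) (Quaternion ℝ))))
      + qk • (circ (compK A) * (Tm (muk μ) μ n₃ ⊗ₖ (1 : Matrix (Fin r) (Fin r) (Quaternion ℝ)))))
    * unfold3 B)

/-- The index reversal `1 ↦ 1`, `l ↦ n₃ + 2 − l` (1-based), used in the tensor transpose. -/
def revIdx {c : ℕ} (l : Fin c) : Fin c :=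
  if h : l.1 = 0 then l else ⟨c - l.1, by have := l.2; omega⟩

/-- Transpose of a (componentwise real) tensor: transpose each frontal slice and
reverse the order of the transposed slices `2` through `n₃`. -/
def transT {a b c : ℕ} (A : QTensor a b c) : QTensor b a c :=
  fun q p l => A p q (revIdx l)

/-- Right multiplication of a matrix by a quaternion scalar. -/
def rmulM {m n : Type*} (M : Matrix m n (Quaternion ℝ)) (x : Quaternion ℝ) :
    Matrix m n (Quaternion ℝ) := fun p q => M p q * x

/-- Conjugate transpose of a third-order quaternion tensor. -/
def conjT {n₁ n₂ n₃ : ℕ} (μ : Quaternion ℝ) (A : QTensor n₁ n₂ n₃) : QTensor n₂ n₁ n₃ :=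
  fold3 (unfold3 (transT (compE A))
    - rmulM (((Tm (mui μ) μ n₃)ᴴ ⊗ₖ (1 : Matrix (Fin n₂) (Fin n₂) (Quaternion ℝ)))
        * unfold3 (transT (compI A))) qi
    - rmulM (((Tm (muj μ) μ n₃)ᴴ ⊗ₖ (1 : Matrix (Fin n₂) (Fin n₂) (Quaternion ℝ)))
        * unfold3 (transT (compJ A))) qj
    - rmulM (((Tm (muk μ) μ n₃)ᴴ ⊗ₖ (1 : Matrix (Fin n₂) (Fin n₂) (Quaternion ℝ)))
        * unfold3 (transT (compK A))) qk)

/-- The identity tensor: first frontal slice is the identity, the others vanish. -/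
def idT (n l : ℕ) : QTensor n n l :=
  fun p q m => if m.1 = 0 ∧ p = q then 1 else 0

/-- Unitary tensor with respect to the gQt-product. -/
def unitaryT {n n₃ : ℕ} (μ : Quaternion ℝ) (U : QTensor n n n₃) : Prop :=
  gQt μ (conjT μ U) U = idT n n₃ ∧ gQt μ U (conjT μ U) = idT n n₃

/-- f-diagonal tensor: each frontal slice is a diagonal matrix. -/
def fDiag {a b c : ℕ} (S : QTensor a b c) : Prop :=
  ∀ p q l, p.1 ≠ q.1 → S p q l = 0


/-- Factorization energies of a third-order quaternion tensor through the gQt-product. -/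
def tenFacSet {n₁ n₂ n₃ : ℕ} (μ : Quaternion ℝ) (A : QTensor n₁ n₂ n₃) : Set ℝ :=
  { x | ∃ (m : ℕ) (X : QTensor n₁ m n₃) (Y : QTensor n₂ m n₃),
      A = gQt μ X (conjT μ Y) ∧ x = (frobT X ^ 2 + frobT Y ^ 2) / 2 }

/-- Factorization energies of a quaternion matrix. -/
def matFacSet {n₁ n₂ : ℕ} (M : Matrix (Fin n₁) (Fin n₂) (Quaternion ℝ)) : Set ℝ :=
  { x | ∃ (m : ℕ) (X : Matrix (Fin n₁) (Fin m) (Quaternion ℝ))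
      (Y : Matrix (Fin n₂) (Fin m) (Quaternion ℝ)),
      M = X * Yᴴ ∧ x = (frobM X ^ 2 + frobM Y ^ 2) / 2 }

section DFT

/-- The normalized complex DFT matrix, with entries `(1/√n) exp(2πi/n)^{pq}`. -/
def complexDFT (n : ℕ) : Matrix (Fin n) (Fin n) ℂ :=
  fun p q => ((1 / Real.sqrt n : ℝ) : ℂ) * Complex.exp (2 * Real.pi * Complex.I / n) ^ (p.1 * q.1)

lemma conjTranspose_complexDFT_mul_self (n : ℕ) : (complexDFT n)ᴴ * complexDFT n = 1 := by
  ext p q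
  have hn : n ≠ 0 := by have := p.2; omega
  have hprim := Complex.isPrimitiveRoot_exp n hn
  set ζ := Complex.exp (2 * Real.pi * Complex.I / n) with hζ
  have hζ0 : ζ ≠ 0 := Complex.exp_ne_zero _
  have hstar : star ζ = ζ⁻¹ := by
    have h1 : ‖ζ‖ = 1 := hprim.norm'_eq_one hn
    exact (Complex.inv_eq_conj h1).symm
  set z : ℂ := ζ⁻¹ ^ p.1 * ζ ^ q.1 with hz
  have hsq : ((1 / Real.sqrt n : ℝ) : ℂ) * ((1 / Real.sqrt n : ℝ) : ℂ) = (n : ℂ)⁻¹ := by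
    rw [← Complex.ofReal_mul, div_mul_div_comm, Real.mul_self_sqrt (Nat.cast_nonneg n)]
    push_cast
    simp
  have hterm : ∀ m : Fin n, star (complexDFT n m p) * complexDFT n m q
      = (n : ℂ)⁻¹ * z ^ (m.1) := by
    intro m
    simp only [complexDFT, ← hζ, star_mul', star_pow, hstar]
    rw [show star ((1 / Real.sqrt n : ℝ) : ℂ) = ((1 / Real.sqrt n : ℝ) : ℂ) from
      Complex.conj_ofReal _, ← hsq, hz, mul_pow, ← pow_mul, ← pow_mul, mul_comm p.1, mul_comm q.1]
    ring
  rw [Matrix.mul_apply]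
  simp only [Matrix.conjTranspose_apply, hterm]
  rw [← Finset.mul_sum, Fin.sum_univ_eq_sum_range (fun m => z ^ m) n]
  have hnC : (n : ℂ) ≠ 0 := Nat.cast_ne_zero.mpr hn
  by_cases hpq : p = q
  · subst hpq
    have : z = 1 := by rw [hz, ← mul_pow, inv_mul_cancel₀ hζ0, one_pow]
    simp [this, hnC]
  · have hz1 : z ≠ 1 := by
      intro h
      apply hpq
      rw [hz, inv_pow, inv_mul_eq_one₀ (pow_ne_zero _ hζ0)] at h
      exact Fin.ext (hprim.pow_inj p.2 q.2 h)
    have hzn : z ^ n = 1 := by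
      rw [hz, mul_pow, ← pow_mul, ← pow_mul, mul_comm p.1, mul_comm q.1, pow_mul, pow_mul, inv_pow,
        hprim.pow_eq_one]
      simp
    rw [geom_sum_eq hz1, hzn]
    simp [hpq]

lemma complexDFT_sub (n : ℕ) (l p q : Fin n) :
    complexDFT n l p = (Real.sqrt n : ℂ) * (complexDFT n l (p - q) * complexDFT n l q) := by
  have hn : n ≠ 0 := by have := p.2; omega
  have hprim := Complex.isPrimitiveRoot_exp n hn
  have hs : (Real.sqrt n : ℂ) ≠ 0 := by
    rw [Ne, Complex.ofReal_eq_zero, Real.sqrt_eq_zero (Nat.cast_nonneg n)]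
    exact_mod_cast hn
  simp only [complexDFT]
  set ζ := Complex.exp (2 * Real.pi * Complex.I / n) with hζ
  have key : ζ ^ (l.1 * p.1) = ζ ^ (l.1 * (p - q).1) * ζ ^ (l.1 * q.1) := by
    rw [← pow_add, ← mul_add, mul_comm, mul_comm l.1, pow_mul, pow_mul]
    congr 1
    rw [← pow_mod_orderOf ζ p.1, ← pow_mod_orderOf ζ (_ + _), ← hprim.eq_orderOf]
    congr 1
    have : (((p - q) + q : Fin n)).1 = p.1 := by
      have : NeZero n := ⟨hn⟩
      rw [sub_add_cancel]
    rw [← this, Fin.val_add, Nat.mod_mod]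
  rw [key]
  push_cast
  field_simp

lemma complexDFT_revIdx (n : ℕ) (l m : Fin n) :
    complexDFT n l (revIdx m) = star (complexDFT n l m) := by
  have hn : n ≠ 0 := by have := m.2; omega
  have hprim := Complex.isPrimitiveRoot_exp n hn
  simp only [complexDFT]
  set ζ := Complex.exp (2 * Real.pi * Complex.I / n) with hζ
  have hζ0 : ζ ≠ 0 := Complex.exp_ne_zero _
  have hstar : star ζ = ζ⁻¹ := (Complex.inv_eq_conj (hprim.norm'_eq_one hn)).symm
  rw [star_mul', star_pow, hstar,
    show star ((1 / Real.sqrt n : ℝ) : ℂ) = ((1 / Real.sqrt n : ℝ) : ℂ) from Complex.conj_ofReal _]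
  congr 1
  unfold revIdx
  split_ifs with h
  · simp [h]
  · rw [inv_pow]
    apply eq_inv_of_mul_eq_one_left
    rw [← pow_add, ← mul_add, Nat.sub_add_cancel m.2.le, mul_comm, pow_mul, hprim.pow_eq_one,
      one_pow]

end DFT

section UnitPure

variable {μ : Quaternion ℝ}

lemma UnitPure.sq_sum (h : UnitPure μ) : μ.imI ^ 2 + μ.imJ ^ 2 + μ.imK ^ 2 = 1 := by
  have h1 := Quaternion.normSq_eq_norm_mul_self μ
  rw [h.2, Quaternion.normSq_def', h.1] at h1
  linarith

lemma UnitPure.of_sq_sum (h0 : μ.re = 0) (h : μ.imI ^ 2 + μ.imJ ^ 2 + μ.imK ^ 2 = 1) :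
    UnitPure μ := by
  refine ⟨h0, ?_⟩
  have h1 := Quaternion.normSq_eq_norm_mul_self μ
  rw [Quaternion.normSq_def', h0] at h1
  nlinarith [norm_nonneg μ]

lemma UnitPure.mui (h : UnitPure μ) : UnitPure (mui μ) :=
  .of_sq_sum rfl (by simpa [QTpaper.mui] using h.sq_sum)

lemma UnitPure.muj (h : UnitPure μ) : UnitPure (muj μ) :=
  .of_sq_sum rfl (by simpa [QTpaper.muj] using h.sq_sum)

lemma UnitPure.muk (h : UnitPure μ) : UnitPure (muk μ) :=
  .of_sq_sum rfl (by simpa [QTpaper.muk] using h.sq_sum)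

lemma UnitPure.star_eq (h : UnitPure μ) : star μ = -μ := by
  ext <;> simp [h.1]

lemma UnitPure.neg_mul_neg_self (h : UnitPure μ) : -μ * -μ = -1 := by
  rw [mul_neg, ← h.star_eq, Quaternion.star_mul_self, Quaternion.normSq_eq_norm_mul_self, h.2]
  simp

/-- The embedding of `ℂ` in `ℍ` that sends `I` to `-μ`. -/
def UnitPure.embed (h : UnitPure μ) : ℂ →ₐ[ℝ] Quaternion ℝ :=
  Complex.liftAux (-μ) h.neg_mul_neg_self

lemma UnitPure.embed_apply (h : UnitPure μ) (z : ℂ) :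
    h.embed z = ((z.re : ℝ) : Quaternion ℝ) - ((z.im : ℝ) : Quaternion ℝ) * μ := by
  rw [embed, Complex.liftAux_apply, smul_neg, sub_eq_add_neg, Quaternion.coe_mul_eq_smul]
  rfl

lemma UnitPure.embed_star (h : UnitPure μ) (z : ℂ) : h.embed (star z) = star (h.embed z) := by
  rw [h.embed_apply, h.embed_apply]
  ext <;> simp [h.1, mul_comm]

lemma UnitPure.embed_ofReal (h : UnitPure μ) (x : ℝ) :
    h.embed (x : ℂ) = (x : Quaternion ℝ) := by
  simp [h.embed_apply]

lemma UnitPure.Fq_eq_map (h : UnitPure μ) (n : ℕ) : Fq μ n = (complexDFT n).map h.embed := by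
  ext1 p q
  rw [Matrix.map_apply, complexDFT, map_mul, h.embed_ofReal, Fq, ← Complex.exp_nat_mul]
  congr 1
  have : ((p.1 * q.1 : ℕ) : ℂ) * (2 * Real.pi * Complex.I / n)
      = ((2 * Real.pi * (p.1 * q.1) / n : ℝ) : ℂ) * Complex.I := by
    push_cast; ring
  rw [this, h.embed_apply, Complex.exp_ofReal_mul_I_re, Complex.exp_ofReal_mul_I_im]

lemma UnitPure.conjTranspose_Fq_mul_self (h : UnitPure μ) (n : ℕ) :
    (Fq μ n)ᴴ * Fq μ n = 1 := by
  have hH : ((complexDFT n).map h.embed)ᴴ = (complexDFT n)ᴴ.map h.embed := by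
    ext1 p q
    simp only [Matrix.conjTranspose_apply, Matrix.map_apply, h.embed_star]
  rw [h.Fq_eq_map, hH, ← Matrix.map_mul, conjTranspose_complexDFT_mul_self]
  exact Matrix.map_one _ (map_zero _) (map_one _)

lemma UnitPure.Fq_mul_conjTranspose_self (h : UnitPure μ) (n : ℕ) :
    Fq μ n * (Fq μ n)ᴴ = 1 := by
  have hH : ((complexDFT n).map h.embed)ᴴ = (complexDFT n)ᴴ.map h.embed := by
    ext1 p q
    simp only [Matrix.conjTranspose_apply, Matrix.map_apply, h.embed_star]
  rw [h.Fq_eq_map, hH, ← Matrix.map_mul,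
    mul_eq_one_comm.mp (conjTranspose_complexDFT_mul_self n)]
  exact Matrix.map_one _ (map_zero _) (map_one _)

lemma UnitPure.Fq_sub (h : UnitPure μ) {n : ℕ} (l p q : Fin n) :
    Fq μ n l p = ((Real.sqrt n : ℝ) : Quaternion ℝ) * (Fq μ n l (p - q) * Fq μ n l q) := by
  simp only [h.Fq_eq_map, Matrix.map_apply]
  rw [complexDFT_sub n l p q, map_mul, map_mul, h.embed_ofReal]

lemma UnitPure.Fq_revIdx (h : UnitPure μ) {n : ℕ} (l m : Fin n) :
    Fq μ n l (revIdx m) = star (Fq μ n l m) := by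
  simp only [h.Fq_eq_map, Matrix.map_apply, complexDFT_revIdx, h.embed_star]

lemma Fq_mul_of_intertwine {ν x : Quaternion ℝ} (hx : μ * x = x * ν) {n : ℕ} (p q : Fin n) :
    Fq μ n p q * x = x * Fq ν n p q := by
  simp only [Fq, sub_mul, mul_sub, mul_assoc, hx]
  simp only [Quaternion.coe_mul_eq_smul, mul_smul_comm, Quaternion.mul_coe_eq_smul]

lemma UnitPure.mul_qi (h : UnitPure μ) : μ * qi = qi * QTpaper.mui μ := by
  ext <;> simp only [Quaternion.re_mul, Quaternion.imI_mul, Quaternion.imJ_mul, Quaternion.imK_mul] <;>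
    simp [qi, QTpaper.mui, h.1]

lemma UnitPure.mul_qj (h : UnitPure μ) : μ * qj = qj * QTpaper.muj μ := by
  ext <;> simp only [Quaternion.re_mul, Quaternion.imI_mul, Quaternion.imJ_mul, Quaternion.imK_mul] <;>
    simp [qj, QTpaper.muj, h.1]

lemma UnitPure.mul_qk (h : UnitPure μ) : μ * qk = qk * QTpaper.muk μ := by
  ext <;> simp only [Quaternion.re_mul, Quaternion.imI_mul, Quaternion.imJ_mul, Quaternion.imK_mul] <;>
    simp [qk, QTpaper.muk, h.1]

end UnitPure

section TensorAlgebra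

variable {a b c d : ℕ} {μ : Quaternion ℝ}

lemma fftT_apply_eq_smul_mulVec (A : QTensor a b c) (p : Fin a) (q : Fin b) :
    fftT μ A p q = Real.sqrt c • (Fq μ c *ᵥ A p q) := by
  ext1 l
  rw [fftT, Quaternion.coe_mul_eq_smul]
  rfl

lemma UnitPure.Fq_mul_circulant (h : UnitPure μ) (v : Fin c → ℝ) :
    Fq μ c * circulant (fun l => (v l : Quaternion ℝ))
      = diagonal (Real.sqrt c • (Fq μ c *ᵥ fun l => (v l : Quaternion ℝ))) * Fq μ c := by
  ext1 l q
  have : NeZero c := ⟨by have := l.2; omega⟩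
  rw [Matrix.mul_apply, Matrix.diagonal_mul, Pi.smul_apply, Matrix.mulVec, dotProduct,
    ← Equiv.sum_comp (Equiv.subRight q)
      (fun r => Fq μ c l r * (v r : Quaternion ℝ)), Finset.smul_sum, Finset.sum_mul]
  refine Finset.sum_congr rfl fun p _ => ?_
  rw [h.Fq_sub l p q, circulant_apply, Equiv.subRight_apply, Quaternion.coe_mul_eq_smul,
    Quaternion.mul_coe_eq_smul, Quaternion.mul_coe_eq_smul, smul_mul_assoc, smul_mul_assoc,
    smul_comm]

lemma circ_mul_kronecker_one (A : QTensor a b c) (T : Matrix (Fin c) (Fin c) (Quaternion ℝ))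
    (l m : Fin c) (p : Fin a) (r : Fin b) :
    (circ A * (T ⊗ₖ (1 : Matrix (Fin b) (Fin b) (Quaternion ℝ)))) (l, p) (m, r)
      = (circulant (A p r) * T) l m := by
  rw [Matrix.mul_apply, Matrix.mul_apply, Fintype.sum_prod_type]
  refine Finset.sum_congr rfl fun s _ => ?_
  simp [circ, Matrix.one_apply, Matrix.kroneckerMap_apply]

lemma gQt_apply_eq_sum_mulVec (A : QTensor a b c) (B : QTensor b d c) (p : Fin a) (q : Fin d) :
    gQt μ A B p q = ∑ r, (circulant (compE A p r)
      + qi • (circulant (compI A p r) * Tm (mui μ) μ c)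
      + qj • (circulant (compJ A p r) * Tm (muj μ) μ c)
      + qk • (circulant (compK A p r) * Tm (muk μ) μ c)) *ᵥ B r q := by
  ext1 l
  rw [gQt, fold3, Matrix.mul_apply, Fintype.sum_prod_type, Finset.sum_comm, Finset.sum_apply]
  refine Finset.sum_congr rfl fun r _ => Finset.sum_congr rfl fun m _ => ?_
  simp only [Matrix.add_apply, Matrix.smul_apply, circ_mul_kronecker_one]
  rfl

lemma Fq_mul_smul_circulant_mul_Tm {ν x : Quaternion ℝ} (hν : UnitPure ν)
    (hx : μ * x = x * ν) (v : Fin c → ℝ) :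
    Fq μ c * (x • (circulant (fun l => (v l : Quaternion ℝ)) * Tm ν μ c))
      = diagonal (Real.sqrt c • (Fq μ c *ᵥ fun l => x * (v l : Quaternion ℝ))) * Fq μ c := by
  have h1 : ∀ M : Matrix (Fin c) (Fin c) (Quaternion ℝ), Fq μ c * (x • M) = x • (Fq ν c * M) := by
    intro M
    ext1 l q
    rw [Matrix.smul_apply, Matrix.mul_apply, Matrix.mul_apply, Finset.smul_sum]
    refine Finset.sum_congr rfl fun p _ => ?_
    rw [Matrix.smul_apply, smul_eq_mul, smul_eq_mul, ← mul_assoc, ← mul_assoc,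
      Fq_mul_of_intertwine hx]
  rw [h1, Tm, ← Matrix.mul_assoc, hν.Fq_mul_circulant, Matrix.mul_assoc, ← Matrix.mul_assoc (Fq ν c),
    hν.Fq_mul_conjTranspose_self, Matrix.one_mul]
  ext1 l q
  rw [Matrix.smul_apply, Matrix.diagonal_mul, Matrix.diagonal_mul, smul_eq_mul, ← mul_assoc]
  congr 1
  simp only [Pi.smul_apply, Matrix.mulVec, dotProduct, mul_smul_comm, Finset.mul_sum]
  congr 1
  refine Finset.sum_congr rfl fun p _ => ?_
  rw [← mul_assoc, ← mul_assoc, Fq_mul_of_intertwine hx]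

lemma eq_sum_components (x : Quaternion ℝ) :
    x = (x.re : Quaternion ℝ) + qi * (x.imI : Quaternion ℝ) + qj * (x.imJ : Quaternion ℝ)
      + qk * (x.imK : Quaternion ℝ) := by
  ext <;> simp only [Quaternion.re_add, Quaternion.imI_add, Quaternion.imJ_add, Quaternion.imK_add,
    Quaternion.re_mul, Quaternion.imI_mul, Quaternion.imJ_mul, Quaternion.imK_mul] <;>
    simp [qi, qj, qk]

/-- The QDFT turns the gQt-product into the slicewise matrix product. -/
lemma UnitPure.fslice_fftT_gQt (h : UnitPure μ) (A : QTensor a b c) (B : QTensor b d c)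
    (l : Fin c) :
    fslice (fftT μ (gQt μ A B)) l = fslice (fftT μ A) l * fslice (fftT μ B) l := by
  ext1 p q
  have key : ∀ r, Fq μ c * (circulant (compE A p r)
      + qi • (circulant (compI A p r) * Tm (QTpaper.mui μ) μ c)
      + qj • (circulant (compJ A p r) * Tm (QTpaper.muj μ) μ c)
      + qk • (circulant (compK A p r) * Tm (QTpaper.muk μ) μ c))
      = diagonal (fftT μ A p r) * Fq μ c := by
    intro r
    have e : A p r = (fun l => ((A p r l).re : Quaternion ℝ))
        + (fun l => qi * ((A p r l).imI : Quaternion ℝ))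
        + (fun l => qj * ((A p r l).imJ : Quaternion ℝ))
        + (fun l => qk * ((A p r l).imK : Quaternion ℝ)) :=
      funext fun l => eq_sum_components _
    rw [Matrix.mul_add, Matrix.mul_add, Matrix.mul_add]
    unfold compE compI compJ compK
    rw [h.Fq_mul_circulant, Fq_mul_smul_circulant_mul_Tm h.mui h.mul_qi,
      Fq_mul_smul_circulant_mul_Tm h.muj h.mul_qj, Fq_mul_smul_circulant_mul_Tm h.muk h.mul_qk,
      ← Matrix.add_mul, ← Matrix.add_mul, ← Matrix.add_mul, Matrix.diagonal_add,
      Matrix.diagonal_add, Matrix.diagonal_add, fftT_apply_eq_smul_mulVec]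
    congr 2
    conv_rhs => rw [e]
    simp only [Matrix.mulVec_add, smul_add]
    rfl
  simp only [fslice, Matrix.mul_apply]
  rw [fftT_apply_eq_smul_mulVec, gQt_apply_eq_sum_mulVec, Matrix.mulVec_sum]
  simp only [Matrix.mulVec_mulVec, key]
  rw [Pi.smul_apply, Finset.sum_apply, Finset.smul_sum]
  refine Finset.sum_congr rfl fun r _ => ?_
  rw [← Matrix.mulVec_mulVec, Matrix.mulVec_diagonal, fftT_apply_eq_smul_mulVec B, Pi.smul_apply,
    mul_smul_comm]

lemma UnitPure.Fq_mulVec_comp_revIdx (h : UnitPure μ) (v : Fin c → ℝ) :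
    (Fq μ c *ᵥ fun l => (v (revIdx l) : Quaternion ℝ))
      = star (Fq μ c *ᵥ fun l => (v l : Quaternion ℝ)) := by
  have hrev : Function.Involutive (revIdx : Fin c → Fin c) := by
    intro l
    by_cases hl : l.1 = 0
    · simp [revIdx, hl]
    · have h2 : c - l.1 ≠ 0 := by have := l.2; omega
      ext
      simp only [revIdx, hl, h2, dite_false]
      have := l.2
      omega
  ext1 l
  rw [Pi.star_apply, Matrix.mulVec, Matrix.mulVec, dotProduct, dotProduct, star_sum,
    ← Equiv.sum_comp hrev.toPerm]
  refine Finset.sum_congr rfl fun m _ => ?_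
  rw [Function.Involutive.coe_toPerm, hrev m, h.Fq_revIdx, star_mul, Quaternion.star_coe,
    Quaternion.coe_mul_eq_smul, Quaternion.mul_coe_eq_smul]

lemma kronecker_one_mul_unfold3 (T : Matrix (Fin c) (Fin c) (Quaternion ℝ))
    (A : QTensor a b c) (l : Fin c) (p : Fin a) (q : Fin b) :
    ((T ⊗ₖ (1 : Matrix (Fin a) (Fin a) (Quaternion ℝ))) * unfold3 A) (l, p) q
      = (T *ᵥ A p q) l := by
  rw [Matrix.mul_apply, Fintype.sum_prod_type]
  refine Finset.sum_congr rfl fun s _ => ?_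
  simp [unfold3, Matrix.one_apply, Matrix.kroneckerMap_apply]

lemma Fq_mulVec_conjTranspose_Tm (hμ : UnitPure μ) {ν x : Quaternion ℝ} (hν : UnitPure ν)
    (hx : μ * x = x * ν) (hs : star x = -x) (v : Fin c → ℝ) :
    (Fq μ c *ᵥ fun l => (((Tm ν μ c)ᴴ *ᵥ fun m => (v (revIdx m) : Quaternion ℝ)) l) * x)
      = -star (Fq μ c *ᵥ fun l => x * (v l : Quaternion ℝ)) := by
  have h1 : ∀ w : Fin c → Quaternion ℝ, (Fq μ c *ᵥ fun l => w l * x)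
      = fun l => (Fq μ c *ᵥ w) l * x := by
    intro w
    ext1 l
    simp only [Matrix.mulVec, dotProduct, Finset.sum_mul, mul_assoc]
  rw [h1, Matrix.mulVec_mulVec, Tm, Matrix.conjTranspose_mul, Matrix.conjTranspose_conjTranspose,
    ← Matrix.mul_assoc, hμ.Fq_mul_conjTranspose_self, Matrix.one_mul, hν.Fq_mulVec_comp_revIdx]
  ext1 l
  rw [Pi.neg_apply, Pi.star_apply, Pi.star_apply, ← neg_eq_iff_eq_neg, ← mul_neg, ← hs, ← star_mul]
  congr 1
  simp only [Matrix.mulVec, dotProduct, Finset.mul_sum, ← mul_assoc, Fq_mul_of_intertwine hx]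

/-- The QDFT turns the tensor conjugate transpose into the slicewise conjugate transpose. -/
lemma UnitPure.fslice_fftT_conjT (h : UnitPure μ) (A : QTensor a b c) (l : Fin c) :
    fslice (fftT μ (conjT μ A)) l = (fslice (fftT μ A) l)ᴴ := by
  ext1 q p
  have e : A p q = (fun l => ((A p q l).re : Quaternion ℝ))
      + (fun l => qi * ((A p q l).imI : Quaternion ℝ))
      + (fun l => qj * ((A p q l).imJ : Quaternion ℝ))
      + (fun l => qk * ((A p q l).imK : Quaternion ℝ)) :=
    funext fun l => eq_sum_components _
  have e' : conjT μ A q p = (fun l => ((A p q (revIdx l)).re : Quaternion ℝ))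
      - (fun l => (((Tm (QTpaper.mui μ) μ c)ᴴ *ᵥ
          fun m => ((A p q (revIdx m)).imI : Quaternion ℝ)) l) * qi)
      - (fun l => (((Tm (QTpaper.muj μ) μ c)ᴴ *ᵥ
          fun m => ((A p q (revIdx m)).imJ : Quaternion ℝ)) l) * qj)
      - (fun l => (((Tm (QTpaper.muk μ) μ c)ᴴ *ᵥ
          fun m => ((A p q (revIdx m)).imK : Quaternion ℝ)) l) * qk) := by
    ext1 l
    simp only [conjT, fold3, Matrix.sub_apply, rmulM, kronecker_one_mul_unfold3]
    rfl
  have hi : star qi = -qi := UnitPure.star_eq (.of_sq_sum rfl (by simp [qi]))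
  have hj : star qj = -qj := UnitPure.star_eq (.of_sq_sum rfl (by simp [qj]))
  have hk : star qk = -qk := UnitPure.star_eq (.of_sq_sum rfl (by simp [qk]))
  have key : Fq μ c *ᵥ conjT μ A q p = star (Fq μ c *ᵥ A p q) := by
    rw [e', Matrix.mulVec_sub, Matrix.mulVec_sub, Matrix.mulVec_sub,
      h.Fq_mulVec_comp_revIdx (fun l => (A p q l).re),
      Fq_mulVec_conjTranspose_Tm h h.mui h.mul_qi hi (fun l => (A p q l).imI),
      Fq_mulVec_conjTranspose_Tm h h.muj h.mul_qj hj (fun l => (A p q l).imJ),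
      Fq_mulVec_conjTranspose_Tm h h.muk h.mul_qk hk (fun l => (A p q l).imK)]
    conv_rhs => rw [e]
    simp only [Matrix.mulVec_add, star_add, sub_neg_eq_add]
  rw [Matrix.conjTranspose_apply, fslice, fslice, fftT_apply_eq_smul_mulVec,
    fftT_apply_eq_smul_mulVec, key, Pi.smul_apply, Pi.smul_apply, Quaternion.star_smul]
  rfl

lemma UnitPure.fftT_injective (h : UnitPure μ) :
    Function.Injective (fftT μ : QTensor a b c → QTensor a b c) := by
  intro A B hAB
  ext1 p
  ext1 q
  rcases Nat.eq_zero_or_pos c with rfl | hc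
  · exact Subsingleton.elim _ _
  have hs : Real.sqrt c ≠ 0 := (Real.sqrt_pos.mpr (Nat.cast_pos.mpr hc)).ne'
  have h1 := congrFun (congrFun hAB p) q
  rw [fftT_apply_eq_smul_mulVec, fftT_apply_eq_smul_mulVec] at h1
  have h2 := congrArg ((Fq μ c)ᴴ *ᵥ ·) (smul_right_injective _ hs h1)
  simpa [Matrix.mulVec_mulVec, h.conjTranspose_Fq_mul_self] using h2

lemma UnitPure.fftT_surjective (h : UnitPure μ) :
    Function.Surjective (fftT μ : QTensor a b c → QTensor a b c) := by
  intro B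
  refine ⟨fun p q => (Real.sqrt c)⁻¹ • ((Fq μ c)ᴴ *ᵥ B p q), ?_⟩
  ext1 p
  ext1 q
  rcases Nat.eq_zero_or_pos c with rfl | hc
  · exact Subsingleton.elim _ _
  have hs : Real.sqrt c ≠ 0 := (Real.sqrt_pos.mpr (Nat.cast_pos.mpr hc)).ne'
  rw [fftT_apply_eq_smul_mulVec, Matrix.mulVec_smul, Matrix.mulVec_mulVec,
    h.Fq_mul_conjTranspose_self, Matrix.one_mulVec, smul_inv_smul₀ hs]

lemma coe_sum_norm_sq (v : Fin c → Quaternion ℝ) :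
    ((∑ l, ‖v l‖ ^ 2 : ℝ) : Quaternion ℝ) = star v ⬝ᵥ v := by
  rw [dotProduct]
  refine (map_sum (algebraMap ℝ (Quaternion ℝ)) (fun l => ‖v l‖ ^ 2) Finset.univ).trans ?_
  refine Finset.sum_congr rfl fun l _ => ?_
  rw [Pi.star_apply, Quaternion.star_mul_self, Quaternion.normSq_eq_norm_mul_self, sq]
  rfl

lemma UnitPure.sum_norm_sq_Fq_mulVec (h : UnitPure μ) (v : Fin c → Quaternion ℝ) :
    ∑ l, ‖(Fq μ c *ᵥ v) l‖ ^ 2 = ∑ l, ‖v l‖ ^ 2 := by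
  apply Quaternion.coe_injective
  rw [coe_sum_norm_sq, coe_sum_norm_sq, Matrix.star_mulVec, ← Matrix.dotProduct_mulVec,
    Matrix.mulVec_mulVec, h.conjTranspose_Fq_mul_self, Matrix.one_mulVec]

lemma frobM_sq (M : Matrix (Fin a) (Fin b) (Quaternion ℝ)) :
    frobM M ^ 2 = ∑ p, ∑ q, ‖M p q‖ ^ 2 :=
  Real.sq_sqrt (by positivity)

/-- Parseval identity for the QDFT of a tensor. -/
lemma UnitPure.frobT_sq (h : UnitPure μ) (A : QTensor a b c) :
    frobT A ^ 2 = (1 / (c : ℝ)) * ∑ l, frobM (fslice (fftT μ A) l) ^ 2 := by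
  rw [frobT, Real.sq_sqrt (by positivity)]
  rcases Nat.eq_zero_or_pos c with rfl | hc
  · simp
  have hc' : (c : ℝ) ≠ 0 := Nat.cast_ne_zero.mpr hc.ne'
  simp only [frobM_sq, fslice]
  conv_rhs => rw [Finset.sum_comm, Finset.mul_sum]
  refine Finset.sum_congr rfl fun p _ => ?_
  conv_rhs => rw [Finset.sum_comm, Finset.mul_sum]
  refine Finset.sum_congr rfl fun q _ => ?_
  rw [fftT_apply_eq_smul_mulVec]
  simp only [Pi.smul_apply, norm_smul, mul_pow, Real.norm_eq_abs, sq_abs,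
    Real.sq_sqrt (Nat.cast_nonneg c)]
  rw [← Finset.mul_sum, h.sum_norm_sq_Fq_mulVec, ← mul_assoc, one_div, inv_mul_cancel₀ hc', one_mul]

lemma UnitPure.eq_gQt_conjT_iff (h : UnitPure μ) (A : QTensor a b c) (X : QTensor a d c)
    (Y : QTensor b d c) :
    A = gQt μ X (conjT μ Y) ↔
      ∀ l, fslice (fftT μ A) l = fslice (fftT μ X) l * (fslice (fftT μ Y) l)ᴴ := by
  simp only [← h.fslice_fftT_conjT, ← h.fslice_fftT_gQt]
  refine ⟨fun e l => by rw [← e], fun e => h.fftT_injective ?_⟩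
  ext1 p
  ext1 q
  ext1 l
  exact congrFun (congrFun (e l) p) q

end TensorAlgebra

section Attainment

variable {a b : ℕ}

/-- Carathéodory's theorem for cones: a sum of elements of a cone is a sum of at most
`finrank + 1` of its elements. -/
lemma exists_sum_fin_eq_of_cone {E : Type*} [AddCommGroup E] [Module ℝ E] [FiniteDimensional ℝ E]
    {C : Set E} (h0 : (0 : E) ∈ C) (hC : ∀ t : ℝ, 0 ≤ t → ∀ x ∈ C, t • x ∈ C) {m : ℕ}
    (f : Fin m → E) (hf : ∀ i, f i ∈ C) :
    ∃ g : Fin (Module.finrank ℝ E + 1) → E, (∀ i, g i ∈ C) ∧ ∑ i, g i = ∑ i, f i := by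
  rcases Nat.eq_zero_or_pos m with rfl | hm
  · exact ⟨fun _ => 0, fun _ => h0, by simp⟩
  have hm' : (m : ℝ) ≠ 0 := Nat.cast_ne_zero.mpr hm.ne'
  have hmem : ∑ i, f i ∈ convexHull ℝ C :=
    mem_convexHull_of_exists_fintype (fun _ => (m : ℝ)⁻¹) (fun i => (m : ℝ) • f i)
      (fun _ => by positivity) (by simp [hm']) (fun i => hC _ (Nat.cast_nonneg m) _ (hf i))
      (by simp [smul_smul, hm'])
  obtain ⟨ι, _, z, w, hz, haff, hw, -, hsum⟩ := eq_pos_convex_span_of_mem_convexHull hmem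
  have hcard : Fintype.card ι ≤ Module.finrank ℝ E + 1 :=
    haff.card_le_finrank_succ.trans (Nat.succ_le_succ (Submodule.finrank_le _))
  obtain ⟨φ⟩ := Function.Embedding.nonempty_of_card_le
    (α := ι) (β := Fin (Module.finrank ℝ E + 1)) (by simpa using hcard)
  refine ⟨Function.extend φ (fun i => w i • z i) 0, fun k => ?_, ?_⟩
  · by_cases hk : ∃ i, φ i = k
    · obtain ⟨i, rfl⟩ := hk
      rw [φ.injective.extend_apply]
      exact hC _ (hw i).le _ (hz ⟨i, rfl⟩)
    · rw [Function.extend_apply' _ _ _ hk]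
      exact h0
  · rw [← hsum]
    refine (Finset.sum_of_injOn φ φ.injective.injOn (by simp) (fun k _ hk => ?_) fun i _ => ?_).symm
    · rw [Function.extend_apply' _ _ _ (by simpa using hk)]
      rfl
    · rw [φ.injective.extend_apply]

/-- Pairs of a matrix of rank at most one and the energy of one of its factorizations. -/
def rankOneEnergies (a b : ℕ) : Set ((Fin a → Fin b → Quaternion ℝ) × ℝ) :=
  { z | ∃ (x : Fin a → Quaternion ℝ) (y : Fin b → Quaternion ℝ),
      z = (fun p q => x p * star (y q), (∑ p, ‖x p‖ ^ 2 + ∑ q, ‖y q‖ ^ 2) / 2) }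

lemma zero_mem_rankOneEnergies : 0 ∈ rankOneEnergies a b :=
  ⟨0, 0, by ext <;> simp⟩

lemma smul_mem_rankOneEnergies {t : ℝ} (ht : 0 ≤ t)
    (z : (Fin a → Fin b → Quaternion ℝ) × ℝ) (hz : z ∈ rankOneEnergies a b) :
    t • z ∈ rankOneEnergies a b := by
  obtain ⟨x, y, rfl⟩ := hz
  refine ⟨Real.sqrt t • x, Real.sqrt t • y, Prod.ext ?_ ?_⟩
  · ext1 p
    ext1 q
    simp [Quaternion.star_smul, smul_smul, Real.mul_self_sqrt ht]
  · simp only [Prod.smul_snd, Pi.smul_apply, norm_smul, mul_pow, Real.norm_eq_abs, sq_abs,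
      Real.sq_sqrt ht, ← Finset.mul_sum, smul_eq_mul]
    ring

lemma energy_eq_sum_columns {m : ℕ} (X : Matrix (Fin a) (Fin m) (Quaternion ℝ))
    (Y : Matrix (Fin b) (Fin m) (Quaternion ℝ)) :
    (frobM X ^ 2 + frobM Y ^ 2) / 2
      = ∑ k, (∑ p, ‖X p k‖ ^ 2 + ∑ q, ‖Y q k‖ ^ 2) / 2 := by
  rw [frobM_sq, frobM_sq, ← Finset.sum_div, Finset.sum_add_distrib, Finset.sum_comm]
  congr 2
  exact Finset.sum_comm

lemma exists_factorization_iff_sum_rankOne (M : Matrix (Fin a) (Fin b) (Quaternion ℝ)) (m : ℕ) (e : ℝ) :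
    (∃ (X : Matrix (Fin a) (Fin m) (Quaternion ℝ)) (Y : Matrix (Fin b) (Fin m) (Quaternion ℝ)),
      M = X * Yᴴ ∧ e = (frobM X ^ 2 + frobM Y ^ 2) / 2) ↔
    ∃ f : Fin m → (Fin a → Fin b → Quaternion ℝ) × ℝ,
      (∀ k, f k ∈ rankOneEnergies a b) ∧ ∑ k, f k = (M, e) := by
  have hsum : ∀ (X : Matrix (Fin a) (Fin m) (Quaternion ℝ))
      (Y : Matrix (Fin b) (Fin m) (Quaternion ℝ)),
      ∑ k, ((fun p q => X p k * star (Y q k) : Fin a → Fin b → Quaternion ℝ),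
        (∑ p, ‖X p k‖ ^ 2 + ∑ q, ‖Y q k‖ ^ 2) / 2)
      = (X * Yᴴ, (frobM X ^ 2 + frobM Y ^ 2) / 2) := by
    intro X Y
    rw [energy_eq_sum_columns]
    refine Prod.ext ?_ (by rw [Prod.snd_sum])
    rw [Prod.fst_sum]
    ext1 p
    ext1 q
    rw [Finset.sum_apply, Finset.sum_apply]
    rfl
  constructor
  · rintro ⟨X, Y, rfl, rfl⟩
    exact ⟨_, fun k => ⟨fun p => X p k, fun q => Y q k, rfl⟩, hsum X Y⟩
  · rintro ⟨f, hf, he⟩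
    choose x y hxy using hf
    have h1 := hsum (Matrix.of fun p k => x k p) (Matrix.of fun q k => y k q)
    simp only [Matrix.of_apply, ← hxy, he] at h1
    exact ⟨_, _, congrArg Prod.fst h1, congrArg Prod.snd h1⟩

/-- The number of columns of a factorization can be bounded without changing its energy. -/
lemma exists_factorization_of_mem_matFacSet {M : Matrix (Fin a) (Fin b) (Quaternion ℝ)} {e : ℝ}
    (he : e ∈ matFacSet M) :
    ∃ (X : Matrix (Fin a)
        (Fin (Module.finrank ℝ ((Fin a → Fin b → Quaternion ℝ) × ℝ) + 1)) (Quaternion ℝ))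
      (Y : Matrix (Fin b)
        (Fin (Module.finrank ℝ ((Fin a → Fin b → Quaternion ℝ) × ℝ) + 1)) (Quaternion ℝ)),
      M = X * Yᴴ ∧ e = (frobM X ^ 2 + frobM Y ^ 2) / 2 := by
  obtain ⟨m, hm⟩ := he
  obtain ⟨f, hf, hsum⟩ := (exists_factorization_iff_sum_rankOne M m e).mp hm
  obtain ⟨g, hg, hgf⟩ := exists_sum_fin_eq_of_cone zero_mem_rankOneEnergies
    (fun _ ht => smul_mem_rankOneEnergies ht) f hf
  exact (exists_factorization_iff_sum_rankOne M _ e).mpr ⟨g, hg, hgf.trans hsum⟩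

lemma exists_isLeast_energy {M : Matrix (Fin a) (Fin b) (Quaternion ℝ)} {N : ℕ}
    (hne : ∃ (X : Matrix (Fin a) (Fin N) (Quaternion ℝ))
      (Y : Matrix (Fin b) (Fin N) (Quaternion ℝ)),
      M = X * Yᴴ) :
    ∃ e, IsLeast { x | ∃ (X : Matrix (Fin a) (Fin N) (Quaternion ℝ))
      (Y : Matrix (Fin b) (Fin N) (Quaternion ℝ)),
      M = X * Yᴴ ∧ x = (frobM X ^ 2 + frobM Y ^ 2) / 2 } e := by
  obtain ⟨X₀, Y₀, h₀⟩ := hne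
  have : ProperSpace (Quaternion ℝ) := FiniteDimensional.proper_real _
  let energy : (Fin a → Fin N → Quaternion ℝ) × (Fin b → Fin N → Quaternion ℝ) → ℝ :=
    fun z => (∑ p, ∑ q, ‖z.1 p q‖ ^ 2 + ∑ p, ∑ q, ‖z.2 p q‖ ^ 2) / 2
  have hcont : Continuous energy := by fun_prop
  let S : Set ((Fin a → Fin N → Quaternion ℝ) × (Fin b → Fin N → Quaternion ℝ)) :=
    { z | (∀ p q, M p q = ∑ k, z.1 p k * star (z.2 q k)) ∧ energy z ≤ energy (X₀, Y₀) }
  have hclosed : IsClosed S := by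
    have hfac : IsClosed { z : (Fin a → Fin N → Quaternion ℝ) × (Fin b → Fin N → Quaternion ℝ) |
        ∀ p q, M p q = ∑ k, z.1 p k * star (z.2 q k) } := by
      simp only [Set.ofPred_forall]
      exact isClosed_iInter fun p => isClosed_iInter fun q =>
        isClosed_eq continuous_const (by fun_prop)
    exact hfac.inter (isClosed_le hcont continuous_const)
  have hbdd : Bornology.IsBounded S := by
    set R := 2 * energy (X₀, Y₀) + 1
    have hR : 0 ≤ R := by positivity
    have hle : ∀ t : ℝ, t ^ 2 ≤ 2 * energy (X₀, Y₀) → t ≤ R := by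
      intro t ht
      nlinarith [sq_nonneg (t - 1)]
    refine (Metric.isBounded_closedBall (x := 0) (r := R)).subset fun z hz => ?_
    have hz2 : ∑ p, ∑ q, ‖z.1 p q‖ ^ 2 + ∑ p, ∑ q, ‖z.2 p q‖ ^ 2 ≤ 2 * energy (X₀, Y₀) := by
      have h2 : (∑ p, ∑ q, ‖z.1 p q‖ ^ 2 + ∑ p, ∑ q, ‖z.2 p q‖ ^ 2) / 2 ≤ energy (X₀, Y₀) := hz.2
      linarith
    have hsingle : ∀ {d : ℕ} (w : Fin d → Fin N → Quaternion ℝ) (p : Fin d) (q : Fin N),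
        ‖w p q‖ ^ 2 ≤ ∑ p, ∑ q, ‖w p q‖ ^ 2 := fun w p q =>
      (Finset.single_le_sum (f := fun q => ‖w p q‖ ^ 2) (fun _ _ => by positivity)
        (Finset.mem_univ q)).trans
      (Finset.single_le_sum (f := fun p => ∑ q, ‖w p q‖ ^ 2) (fun _ _ => by positivity)
        (Finset.mem_univ p))
    have hX : 0 ≤ ∑ p, ∑ q, ‖z.1 p q‖ ^ 2 := by positivity
    have hY : 0 ≤ ∑ p, ∑ q, ‖z.2 p q‖ ^ 2 := by positivity
    rw [mem_closedBall_zero_iff, Prod.norm_def]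
    refine max_le ?_ ?_
    · exact (pi_norm_le_iff_of_nonneg hR).mpr fun p => (pi_norm_le_iff_of_nonneg hR).mpr fun q =>
        hle _ (by linarith [hsingle z.1 p q])
    · exact (pi_norm_le_iff_of_nonneg hR).mpr fun p => (pi_norm_le_iff_of_nonneg hR).mpr fun q =>
        hle _ (by linarith [hsingle z.2 p q])
  have hmem : ∀ (X : Matrix (Fin a) (Fin N) (Quaternion ℝ))
      (Y : Matrix (Fin b) (Fin N) (Quaternion ℝ)),
      (M = X * Yᴴ ↔ ∀ p q, M p q = ∑ k, X p k * star (Y q k)) := fun X Y =>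
    ⟨fun h p q => by rw [h]; rfl, fun h => by ext1 p q; exact h p q⟩
  have henergy : ∀ (X : Matrix (Fin a) (Fin N) (Quaternion ℝ))
      (Y : Matrix (Fin b) (Fin N) (Quaternion ℝ)),
      (frobM X ^ 2 + frobM Y ^ 2) / 2 = energy (X, Y) := fun X Y => by
    rw [frobM_sq, frobM_sq]
  obtain ⟨z, hz, hmin⟩ := (Metric.isCompact_of_isClosed_isBounded hclosed hbdd).exists_isMinOn
    ⟨(X₀, Y₀), (hmem X₀ Y₀).mp h₀, le_rfl⟩ hcont.continuousOn
  refine ⟨energy z, ⟨z.1, z.2, (hmem _ _).mpr hz.1, (henergy _ _).symm⟩, ?_⟩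
  rintro _ ⟨X, Y, hXY, rfl⟩
  rw [henergy]
  by_cases hle : energy (X, Y) ≤ energy (X₀, Y₀)
  · exact isMinOn_iff.mp hmin (X, Y) ⟨(hmem X Y).mp hXY, hle⟩
  · exact hz.2.trans (not_le.mp hle).le

/-- The minimal factorization energy is attained. -/
lemma isLeast_sInf_matFacSet (M : Matrix (Fin a) (Fin b) (Quaternion ℝ)) :
    IsLeast (matFacSet M) (sInf (matFacSet M)) := by
  have hne : ((frobM M ^ 2 + frobM (1 : Matrix (Fin b) (Fin b) (Quaternion ℝ)) ^ 2) / 2)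
      ∈ matFacSet M := ⟨b, M, 1, by simp, rfl⟩
  obtain ⟨X₀, Y₀, h₀, -⟩ := exists_factorization_of_mem_matFacSet hne
  obtain ⟨e, ⟨X, Y, hXY, he⟩, hle⟩ := exists_isLeast_energy ⟨X₀, Y₀, h₀⟩
  have hleast : IsLeast (matFacSet M) e :=
    ⟨⟨_, X, Y, hXY, he⟩, fun x hx => hle (exists_factorization_of_mem_matFacSet hx)⟩
  rwa [hleast.csInf_eq]

end Attainment

/-- the tensor nuclear norm equals the average of the slicewise
matrix nuclear norms, and both infima are attained. -/
theorem tensor_nuclear_norm_eq {n₁ n₂ n₃ : ℕ} (μ : Quaternion ℝ) (hμ : UnitPure μ)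
    (A : QTensor n₁ n₂ n₃) :
    sInf (tenFacSet μ A)
        = (1 / (n₃ : ℝ)) * ∑ l : Fin n₃, sInf (matFacSet (fslice (fftT μ A) l)) ∧
    sInf (tenFacSet μ A) ∈ tenFacSet μ A ∧
    (∀ l : Fin n₃, sInf (matFacSet (fslice (fftT μ A) l)) ∈ matFacSet (fslice (fftT μ A) l)) := by
  have hleast : IsLeast (tenFacSet μ A)
      ((1 / (n₃ : ℝ)) * ∑ l : Fin n₃, sInf (matFacSet (fslice (fftT μ A) l))) := by
    have henergy : ∀ (m : ℕ) (X : QTensor n₁ m n₃) (Y : QTensor n₂ m n₃),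
        (frobT X ^ 2 + frobT Y ^ 2) / 2 = (1 / (n₃ : ℝ)) * ∑ l,
          (frobM (fslice (fftT μ X) l) ^ 2 + frobM (fslice (fftT μ Y) l) ^ 2) / 2 := by
      intro m X Y
      rw [hμ.frobT_sq, hμ.frobT_sq, ← Finset.sum_div, Finset.sum_add_distrib]
      ring
    constructor
    · choose X Y hXY he using fun l : Fin n₃ => exists_factorization_of_mem_matFacSet
        (isLeast_sInf_matFacSet (fslice (fftT μ A) l)).1
      obtain ⟨X', hX'⟩ := hμ.fftT_surjective fun p k l => X l p k
      obtain ⟨Y', hY'⟩ := hμ.fftT_surjective fun q k l => Y l q k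
      refine ⟨_, X', Y', (hμ.eq_gQt_conjT_iff A X' Y').mpr fun l => ?_, ?_⟩
      · rw [hX', hY']
        exact hXY l
      · rw [henergy, hX', hY']
        exact congrArg _ (Finset.sum_congr rfl fun l _ => he l)
    · rintro _ ⟨m, X, Y, hXY, rfl⟩
      rw [henergy]
      refine mul_le_mul_of_nonneg_left (Finset.sum_le_sum fun l _ => ?_) (by positivity)
      exact (isLeast_sInf_matFacSet (fslice (fftT μ A) l)).2
        ⟨m, _, _, (hμ.eq_gQt_conjT_iff A X Y).mp hXY l, rfl⟩
  exact ⟨hleast.csInf_eq, hleast.csInf_eq.symm ▸ hleast.1,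
    fun l => (isLeast_sInf_matFacSet (fslice (fftT μ A) l)).1⟩

end QTpaper
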